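/- (Suboptimality bias formula) Fix a subset S ⊆ {1,…,d}, an index i ∉ S, and a value x_S with P(X_S = x_S) > 0. Let q(·|x_S) and q(·|x_S, x_i) (for each value x_i of X_i with P(X_S = x_S, X_i = x_i) > 0) be probability mass functions on 𝒴 that are strictly positive on the supports of p(·|x_S) and p(·|x_S, x_i) respectively, and define the imperfect-classifier loss improvement Δ_q(x_S, x_i, y) = ℓ(q(·|x_S), y) − ℓ(q(·|x_S, x_i), y). Then E[Δ_q(x_S, X_i, Y) | X_S = x_S] = I(Y; X_i | X_S = x_S) + D_KL(p(·|x_S) ‖ q(·|x_S)) − ∑_{x_i} P(X_i = x_i | X_S = x_S) · D_KL(p(·|x_S, x_i) ‖ q(·|x_S, x_i)). -/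

import Mathlib

open MeasureTheory ProbabilityTheory
open scoped ENNReal NNReal

noncomputable section

variable {Ω : Type}

/-- Conditional probability of `B` given `A`, as a real number. -/
def cpr [MeasureSpace Ω] (A B : Set Ω) : ℝ :=
  (((ℙ : Measure Ω)[|A]) B).toReal

/-- Conditional expectation of `g` given the event `A`. -/
def cexp [MeasureSpace Ω] (A : Set Ω) (g : Ω → ℝ) : ℝ :=
  ∫ ω, g ω ∂((ℙ : Measure Ω)[|A])

/-- Conditional variance of `g` given the event `A`. -/
def cvar [MeasureSpace Ω] (A : Set Ω) (g : Ω → ℝ) : ℝ :=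
  variance g ((ℙ : Measure Ω)[|A])

/-- Conditional pmf of `Y` given the event `A`. -/
def cpmf {𝒴 : Type} [MeasureSpace Ω] (Y : Ω → 𝒴) (A : Set Ω) (y : 𝒴) : ℝ :=
  cpr A {ω | Y ω = y}

/-- Cross-entropy loss `ℓ(q, y) = -log q(y)`. -/
def xent {𝒴 : Type} (q : 𝒴 → ℝ) (y : 𝒴) : ℝ := -Real.log (q y)

/-- `q` is a probability mass function on the finite type `𝒴`. -/
def IsPMF {𝒴 : Type} [Fintype 𝒴] (q : 𝒴 → ℝ) : Prop :=
  (∀ y, 0 ≤ q y) ∧ ∑ y, q y = 1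

/-- Conditional entropy `H(Y | A)` of the finitely-valued `Y` on the event `A`. -/
def entropyOn {𝒴 : Type} [MeasureSpace Ω] [Fintype 𝒴] (Y : Ω → 𝒴) (A : Set Ω) : ℝ :=
  -∑ y, cpmf Y A y * Real.log (cpmf Y A y)

/-- Kullback–Leibler divergence between pmfs on a finite type. -/
def klDivFin {𝒴 : Type} [Fintype 𝒴] (p q : 𝒴 → ℝ) : ℝ :=
  ∑ y, p y * Real.log (p y / q y)

/-- Conditional mutual information `I(Y; Xi | A)` on the event `A`. -/
def cmi {𝒴 𝒳i : Type} [MeasureSpace Ω] [Fintype 𝒴] [Fintype 𝒳i]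
    (Y : Ω → 𝒴) (Xi : Ω → 𝒳i) (A : Set Ω) : ℝ :=
  entropyOn Y A - ∑ xi, cpr A {ω | Xi ω = xi} * entropyOn Y (A ∩ {ω | Xi ω = xi})

/-- The event `X_S = x_S`. -/
def evS {d : ℕ} {𝒳 : Fin d → Type} (X : ∀ i, Ω → 𝒳 i) (S : Finset (Fin d))
    (x : ∀ i, 𝒳 i) : Set Ω :=
  {ω | ∀ i ∈ S, X i ω = x i}

/-- `-log t` valued in `[0, ∞]`, with the convention `-log 0 = +∞`. -/
def negLog (t : ℝ) : ℝ≥0∞ := if t = 0 then ⊤ else ENNReal.ofReal (-Real.log t)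

theorem measurableSet_evS [MeasurableSpace Ω] {d : ℕ} {𝒳 : Fin d → Type}
    [∀ i, MeasurableSpace (𝒳 i)] [∀ i, MeasurableSingletonClass (𝒳 i)]
    {X : ∀ i, Ω → 𝒳 i} (hX : ∀ i, Measurable (X i)) (S : Finset (Fin d)) (x : ∀ i, 𝒳 i) :
    MeasurableSet (evS X S x) := by
  have h : evS X S x = ⋂ i ∈ S, X i ⁻¹' {x i} := by ext ω; simp [evS]
  rw [h]
  exact S.measurableSet_biInter fun i _ => hX i (measurableSet_singleton _)

theorem cpr_nonneg [MeasureSpace Ω] (A B : Set Ω) : 0 ≤ cpr A B := ENNReal.toReal_nonneg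

/-- Chain rule for conditional probabilities. -/
theorem cpr_mul_cpr_inter [MeasureSpace Ω] [IsProbabilityMeasure (ℙ : Measure Ω)]
    {A B : Set Ω} (hA : MeasurableSet A) (hB : MeasurableSet B) (C : Set Ω) :
    cpr A B * cpr (A ∩ B) C = cpr A (B ∩ C) := by
  rw [cpr, cpr, cpr, ← cond_cond_eq_cond_inter hA hB ℙ, ← cond_mul_eq_inter hB C,
    ENNReal.toReal_mul, mul_comm]

theorem integrable_comp_of_finite {α : Type} [MeasurableSpace Ω] [Finite α] [MeasurableSpace α]
    [MeasurableSingletonClass α] (μ : Measure Ω) [IsFiniteMeasure μ] {Z : Ω → α}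
    (hZ : Measurable Z) (f : α → ℝ) : Integrable (fun ω => f (Z ω)) μ :=
  (Integrable.of_finite (μ := μ.map Z) (f := f)).comp_measurable hZ

/-- Conditional expectation of a function of a finitely-valued random variable. -/
theorem cexp_comp_eq_sum {α : Type} [MeasureSpace Ω] [Fintype α] [MeasurableSpace α]
    [MeasurableSingletonClass α] (A : Set Ω) {Z : Ω → α} (hZ : Measurable Z) (f : α → ℝ) :
    cexp A (fun ω => f (Z ω)) = ∑ z, cpmf Z A z * f z := by
  rw [cexp, ← integral_map hZ.aemeasurable (measurable_of_finite f).aestronglyMeasurable,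
    integral_fintype .of_finite]
  refine Finset.sum_congr rfl fun z _ => ?_
  rw [measureReal_def, Measure.map_apply hZ (measurableSet_singleton z), smul_eq_mul]
  rfl

/-- Cross-entropy is entropy plus Kullback–Leibler divergence. -/
theorem entropyOn_add_klDivFin {𝒴 : Type} [MeasureSpace Ω] [Fintype 𝒴] (Y : Ω → 𝒴) (A : Set Ω)
    {q : 𝒴 → ℝ} (hq : ∀ y, 0 < cpmf Y A y → 0 < q y) :
    entropyOn Y A + klDivFin (cpmf Y A) q = ∑ y, cpmf Y A y * xent q y := by
  rw [entropyOn, klDivFin, ← Finset.sum_neg_distrib, ← Finset.sum_add_distrib]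
  refine Finset.sum_congr rfl fun y _ => ?_
  have hnonneg : 0 ≤ cpmf Y A y := cpr_nonneg _ _
  rcases hnonneg.eq_or_lt' with h | h
  · simp [h]
  · rw [Real.log_div h.ne' (hq y h).ne', xent]
    ring

/-- **Suboptimality bias formula.** For an imperfect classifier `q`, the expected
incremental loss improvement equals the CMI plus a difference of KL divergence terms:
`E[Δ_q(x_S, X_i, Y) | X_S = x_S] = I(Y; X_i | X_S = x_S) + D_KL(p(·|x_S) ‖ q(·|x_S))
  − ∑_{x_i} P(X_i = x_i | X_S = x_S) · D_KL(p(·|x_S, x_i) ‖ q(·|x_S, x_i))`. -/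
theorem suboptimality_bias_formula
    [MeasureSpace Ω] [IsProbabilityMeasure (ℙ : Measure Ω)]
    {𝒴 : Type} [Fintype 𝒴] [MeasurableSpace 𝒴] [MeasurableSingletonClass 𝒴]
    {d : ℕ} {𝒳 : Fin d → Type} [∀ i, Fintype (𝒳 i)]
    [∀ i, MeasurableSpace (𝒳 i)] [∀ i, MeasurableSingletonClass (𝒳 i)]
    (X : ∀ i, Ω → 𝒳 i) (Y : Ω → 𝒴)
    (hX : ∀ i, Measurable (X i)) (hY : Measurable Y)
    (S : Finset (Fin d)) (i : Fin d) (hi : i ∉ S)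
    (x : ∀ j, 𝒳 j) (hpos : 0 < (ℙ : Measure Ω) (evS X S x))
    (qS : 𝒴 → ℝ) (qI : 𝒳 i → 𝒴 → ℝ)
    (hqS : IsPMF qS)
    (hqSsupp : ∀ y, 0 < cpmf Y (evS X S x) y → 0 < qS y)
    (hqI : ∀ xi, 0 < cpr (evS X S x) {ω | X i ω = xi} → IsPMF (qI xi))
    (hqIsupp : ∀ xi, 0 < cpr (evS X S x) {ω | X i ω = xi} →
      ∀ y, 0 < cpmf Y (evS X S x ∩ {ω | X i ω = xi}) y → 0 < qI xi y) :
    cexp (evS X S x) (fun ω => xent qS (Y ω) - xent (qI (X i ω)) (Y ω))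
      = cmi Y (X i) (evS X S x)
        + klDivFin (cpmf Y (evS X S x)) qS
        - ∑ xi, cpr (evS X S x) {ω | X i ω = xi}
            * klDivFin (cpmf Y (evS X S x ∩ {ω | X i ω = xi})) (qI xi) := by
  have hA := measurableSet_evS hX S x
  have hXi : ∀ xi, MeasurableSet {ω | X i ω = xi} := fun xi => hX i (measurableSet_singleton xi)
  have hsub : cexp (evS X S x) (fun ω => xent qS (Y ω) - xent (qI (X i ω)) (Y ω))
      = cexp (evS X S x) (fun ω => xent qS (Y ω))
        - cexp (evS X S x) (fun ω => xent (qI (X i ω)) (Y ω)) :=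
    integral_sub (integrable_comp_of_finite _ hY (xent qS))
      (integrable_comp_of_finite _ ((hX i).prodMk hY) fun z => xent (qI z.1) z.2)
  have hcond : cexp (evS X S x) (fun ω => xent (qI (X i ω)) (Y ω))
      = ∑ xi, cpr (evS X S x) {ω | X i ω = xi}
          * (entropyOn Y (evS X S x ∩ {ω | X i ω = xi})
            + klDivFin (cpmf Y (evS X S x ∩ {ω | X i ω = xi})) (qI xi)) := by
    rw [cexp_comp_eq_sum _ ((hX i).prodMk hY) fun z => xent (qI z.1) z.2, Fintype.sum_prod_type]
    refine Finset.sum_congr rfl fun xi _ => ?_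
    have hjoint : ∀ y, cpmf (fun ω => (X i ω, Y ω)) (evS X S x) (xi, y)
        = cpr (evS X S x) {ω | X i ω = xi} * cpmf Y (evS X S x ∩ {ω | X i ω = xi}) y := fun y => by
      rw [cpmf, cpmf, cpr_mul_cpr_inter hA (hXi xi)]
      simp only [Prod.mk.injEq, Set.ofPred_and]
    simp only [hjoint, mul_assoc, ← Finset.mul_sum]
    rcases (cpr_nonneg (evS X S x) {ω | X i ω = xi}).eq_or_lt' with h | h
    · simp [h]
    · rw [entropyOn_add_klDivFin Y _ (hqIsupp xi h)]
  rw [hsub, hcond, cexp_comp_eq_sum _ hY (xent qS), ← entropyOn_add_klDivFin Y _ hqSsupp, cmi]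
  simp only [mul_add, Finset.sum_add_distrib]
  ring
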